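/- arXiv:0808.1281 — 2 statements merged into one kernel-verified Lean document; each statement's English description precedes it below -/
import Mathlib

section
/- Let S, T ⊆ ℝ³ satisfy S ◁ T, and let φ, φ' be compactly supported area-preserving diffeomorphisms of ℝ². Then (φ × id)(S) ◁ (φ' × id)(T). (Proposition: the relation ◁ is well defined on equivalence classes of slices.) -/
noncomputable section

/-- ℝ⁴ with coordinates (x₁, x₂, y₁, y₂). -/
abbrev R4 := ℝ × ℝ × ℝ × ℝ
/-- ℝ² with coordinates (x₁, y₁). -/
abbrev R2 := ℝ × ℝ
/-- ℝ³ with coordinates (x₁, x₂, y₁). -/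
abbrev R3 := ℝ × ℝ × ℝ

/-- The standard symplectic form ω(u,v) = u₁v₃ − u₃v₁ + u₂v₄ − u₄v₂ on ℝ⁴. -/
def omega4 (u v : R4) : ℝ :=
  u.1 * v.2.2.1 - u.2.2.1 * v.1 + u.2.1 * v.2.2.2 - u.2.2.2 * v.2.1

/-- A symplectomorphism of ℝ⁴. -/
def IsSymplectomorphism (ψ : R4 → R4) : Prop :=
  Function.Bijective ψ ∧ ContDiff ℝ (⊤ : ℕ∞) ψ ∧ ContDiff ℝ (⊤ : ℕ∞) (Function.invFun ψ) ∧
  ∀ p u v : R4, omega4 (fderiv ℝ ψ p u) (fderiv ℝ ψ p v) = omega4 u v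

/-- The Hamiltonian vector field of H : ℝ⁴ → ℝ, coordinates (x₁, x₂, y₁, y₂). -/
def HamVF (H : R4 → ℝ) (p : R4) : R4 :=
  (fderiv ℝ H p (0, 0, 1, 0), fderiv ℝ H p (0, 0, 0, 1),
   -fderiv ℝ H p (1, 0, 0, 0), -fderiv ℝ H p (0, 1, 0, 0))

/-- A global Hamiltonian flow of H on ℝ⁴. -/
def IsHamFlow (H : R4 → ℝ) (Φ : ℝ × R4 → R4) : Prop :=
  ContDiff ℝ (⊤ : ℕ∞) Φ ∧ (∀ p, Φ (0, p) = p) ∧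
  ∀ (t : ℝ) (p : R4), HasDerivAt (fun s => Φ (s, p)) (HamVF H (Φ (t, p))) t

/-- A parametrization of a flat-at-infinity planar Lagrangian. -/
def IsFlatParam (f : R2 → R4) : Prop :=
  ContDiff ℝ (⊤ : ℕ∞) f ∧ Function.Injective f ∧ IsProperMap f ∧
  (∀ p : R2, Function.Injective (fderiv ℝ f p)) ∧
  (∀ (p : R2) (u v : R2), omega4 (fderiv ℝ f p u) (fderiv ℝ f p v) = 0) ∧
  ∃ K : Set R2, IsCompact K ∧ ∀ p : R2, p ∉ K → f p = (p.1, p.2, 0, 0)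

/-- A flat-at-infinity planar Lagrangian. -/
def IsFlatLagrangian (L : Set R4) : Prop :=
  ∃ f : R2 → R4, IsFlatParam f ∧ Set.range f = L

/-- `L` is transverse to the hyperplane {y₂ = a}. -/
def TransverseAt (L : Set R4) (a : ℝ) : Prop :=
  ∃ f : R2 → R4, IsFlatParam f ∧ Set.range f = L ∧
    ∀ p : R2, (f p).2.2.2 = a → fderiv ℝ (fun q => (f q).2.2.2) p ≠ 0

/-- An area-preserving diffeomorphism of ℝ². -/
def IsAreaDiffeo (φ : R2 → R2) : Prop :=
  Function.Bijective φ ∧ ContDiff ℝ (⊤ : ℕ∞) φ ∧ ContDiff ℝ (⊤ : ℕ∞) (Function.invFun φ) ∧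
  ∀ p : R2, LinearMap.det ((fderiv ℝ φ p) : R2 →ₗ[ℝ] R2) = 1

/-- φ equals the identity outside a compact set. -/
def IsCompactSupported (φ : R2 → R2) : Prop :=
  ∃ K : Set R2, IsCompact K ∧ ∀ p : R2, p ∉ K → φ p = p

/-- φ × id : ℝ³ → ℝ³. -/
def phiTimesId (φ : R2 → R2) (p : R3) : R3 :=
  ((φ (p.1, p.2.2)).1, p.2.1, (φ (p.1, p.2.2)).2)

/-- The inclusion i_a : ℝ³ → ℝ⁴. -/
def iMap (a : ℝ) (p : R3) : R4 := (p.1, p.2.1, p.2.2, a)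

/-- S ◁ S' : strict Lagrange cobordism relation. -/
def SliceRelStrict (S S' : Set R3) : Prop :=
  ∃ (L : Set R4) (a b : ℝ), a < b ∧ b < 0 ∧ IsFlatLagrangian L ∧
    TransverseAt L a ∧ TransverseAt L b ∧
    L ∩ {p : R4 | p.2.2.2 = a} = iMap a '' S ∧
    L ∩ {p : R4 | p.2.2.2 = b} = iMap b '' S'

/-- S ⊴ S' : non-strict Lagrange cobordism relation. -/
def SliceRel (S S' : Set R3) : Prop :=
  ∃ (L : Set R4) (a b : ℝ), a ≤ b ∧ b < 0 ∧ IsFlatLagrangian L ∧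
    TransverseAt L a ∧ TransverseAt L b ∧
    L ∩ {p : R4 | p.2.2.2 = a} = iMap a '' S ∧
    L ∩ {p : R4 | p.2.2.2 = b} = iMap b '' S'

/-- S ∼ S' : equivalence of slices. -/
def SliceEquiv (S S' : Set R3) : Prop :=
  ∃ φ : R2 → R2, IsAreaDiffeo φ ∧ IsCompactSupported φ ∧ phiTimesId φ '' S = S'

/-- A negative slice. -/
def IsNegativeSlice (S : Set R3) : Prop :=
  ∃ (L : Set R4) (a : ℝ), a < 0 ∧ IsFlatLagrangian L ∧ TransverseAt L a ∧
    L ∩ {p : R4 | p.2.2.2 = a} = iMap a '' S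
/-- Time-dependent Hamiltonian vector field on ℝ⁴. -/
def HamVF4t (H : ℝ × R4 → ℝ) (t : ℝ) (p : R4) : R4 :=
  (fderiv ℝ (fun q => H (t, q)) p (0, 0, 1, 0),
   fderiv ℝ (fun q => H (t, q)) p (0, 0, 0, 1),
   -fderiv ℝ (fun q => H (t, q)) p (1, 0, 0, 0),
   -fderiv ℝ (fun q => H (t, q)) p (0, 1, 0, 0))

/-- A global Hamiltonian flow of a time-dependent Hamiltonian on ℝ⁴. -/
def IsHamFlow4t (H : ℝ × R4 → ℝ) (Φ : ℝ × R4 → R4) : Prop :=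
  ContDiff ℝ (⊤ : ℕ∞) Φ ∧ (∀ p, Φ (0, p) = p) ∧
  ∀ (t : ℝ) (p : R4), HasDerivAt (fun s => Φ (s, p)) (HamVF4t H t (Φ (t, p))) t

/-- Time-dependent Hamiltonian vector field on ℝ², coordinates (x₁, y₁). -/
def HamVF2t (H : ℝ × R2 → ℝ) (t : ℝ) (q : R2) : R2 :=
  (fderiv ℝ (fun r => H (t, r)) q (0, 1), -fderiv ℝ (fun r => H (t, r)) q (1, 0))

/-- A global Hamiltonian flow of a time-dependent Hamiltonian on ℝ². -/
def IsHamFlow2t (H : ℝ × R2 → ℝ) (φ : ℝ × R2 → R2) : Prop :=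
  ContDiff ℝ (⊤ : ℕ∞) φ ∧ (∀ q, φ (0, q) = q) ∧
  ∀ (t : ℝ) (q : R2), HasDerivAt (fun s => φ (s, q)) (HamVF2t H t (φ (t, q))) t

/-- Translation of ℝ⁴ by s in the x₁-direction. -/
def trX1 (s : ℝ) (p : R4) : R4 := (p.1 + s, p.2.1, p.2.2.1, p.2.2.2)

/-- Φ_φ : ℝ⁴ → ℝ⁴ induced by an area-preserving diffeomorphism φ of the x₁y₁-plane. -/
def PhiPhi (φ : R2 → R2) (p : R4) : R4 :=
  ((φ (p.1, p.2.2.1)).1, p.2.1, (φ (p.1, p.2.2.1)).2, p.2.2.2)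
/-- A smooth symplectic bijection with continuous inverse preserving y₂. -/
def GoodMap (ψ : R4 → R4) : Prop :=
  ContDiff ℝ (⊤ : ℕ∞) ψ ∧ IsHomeomorph ψ ∧
  (∀ p u v : R4, omega4 (fderiv ℝ ψ p u) (fderiv ℝ ψ p v) = omega4 u v) ∧
  ∀ p, (ψ p).2.2.2 = p.2.2.2

theorem GoodMap.comp {ψ χ : R4 → R4} (h : GoodMap ψ) (k : GoodMap χ) : GoodMap (ψ ∘ χ) := by
  refine ⟨h.1.comp k.1, h.2.1.comp k.2.1, ?_, ?_⟩
  · intro p u v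
    rw [fderiv_comp p (h.1.differentiable (by simp) _) (k.1.differentiable (by simp) _)]
    simp only [ContinuousLinearMap.comp_apply]
    rw [h.2.2.1, k.2.2.1]
  · intro p
    simp [h.2.2.2, k.2.2.2]

theorem isHomeomorph_of_inverse {ψ χ : R4 → R4} (h : Continuous ψ) (k : Continuous χ)
    (h1 : ∀ p, χ (ψ p) = p) (h2 : ∀ p, ψ (χ p) = p) : IsHomeomorph ψ :=
  (Homeomorph.mk ⟨ψ, χ, h1, h2⟩ h k).isHomeomorph

/-- shear -/
def Th (C c : ℝ) (p : R4) : R4 :=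
  (p.1, p.2.1 - 2 * C * (p.2.2.2 - c) * p.1, p.2.2.1 + C * (p.2.2.2 - c) ^ 2, p.2.2.2)

theorem Th_inv (C c : ℝ) (p : R4) : Th (-C) c (Th C c p) = p := by
  simp only [Th]; ext <;> simp

theorem Th_contDiff (C c : ℝ) : ContDiff ℝ (⊤ : ℕ∞) (Th C c) := by
  unfold Th; fun_prop

theorem Th_fderiv (C c : ℝ) (p u : R4) : fderiv ℝ (Th C c) p u =
    (u.1, u.2.1 - 2 * C * (u.2.2.2 * p.1 + (p.2.2.2 - c) * u.1),
      u.2.2.1 + 2 * C * (p.2.2.2 - c) * u.2.2.2, u.2.2.2) := by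
  have h1 : HasFDerivAt (fun p : R4 => p.1) (ContinuousLinearMap.fst ℝ ℝ (ℝ × ℝ × ℝ)) p :=
    hasFDerivAt_fst
  have h2' : HasFDerivAt (fun p : R4 => p.2) (ContinuousLinearMap.snd ℝ ℝ (ℝ × ℝ × ℝ)) p :=
    hasFDerivAt_snd
  have h2 := h2'.fst
  have h3 := h2'.snd.fst
  have h4 := h2'.snd.snd
  have := h1.prodMk ((h2.sub (((h4.sub_const c).const_mul (2 * C)).mul h1)).prodMk
    ((h3.add (((h4.sub_const c).pow 2).const_mul C)).prodMk h4))
  have h5 : HasFDerivAt (Th C c) _ p := this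
  rw [h5.fderiv]
  ext <;> simp <;> ring

theorem Th_good (C c : ℝ) : GoodMap (Th C c) := by
  refine ⟨Th_contDiff C c, isHomeomorph_of_inverse (Th_contDiff C c).continuous
    (Th_contDiff (-C) c).continuous (Th_inv C c) ?_, ?_, fun p => rfl⟩
  · intro p
    have := Th_inv (-C) c p
    rwa [neg_neg] at this
  · intro p u v
    rw [Th_fderiv, Th_fderiv]
    simp only [omega4]; ring

theorem det_two (A : R2 →ₗ[ℝ] R2) (h : LinearMap.det A = 1) (u v : R2) :
    (A u).1 * (A v).2 - (A u).2 * (A v).1 = u.1 * v.2 - u.2 * v.1 := by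
  have hd : (A (1, 0)).1 * (A (0, 1)).2 - (A (0, 1)).1 * (A (1, 0)).2 = 1 := by
    rw [← LinearMap.det_toMatrix (Module.Basis.finTwoProd ℝ), Matrix.det_fin_two] at h
    simpa [LinearMap.toMatrix_apply] using h
  have key : ∀ w : R2, A w = w.1 • A (1, 0) + w.2 • A (0, 1) := by
    intro w
    rw [← map_smul, ← map_smul, ← map_add]
    congr 1
    ext <;> simp
  rw [key u, key v]
  simp only [Prod.fst_add, Prod.snd_add, Prod.smul_fst, Prod.smul_snd, smul_eq_mul]
  linear_combination (u.1 * v.2 - u.2 * v.1) * hd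

theorem PhiPhi_contDiff {φ : R2 → R2} (h : ContDiff ℝ (⊤ : ℕ∞) φ) :
    ContDiff ℝ (⊤ : ℕ∞) (PhiPhi φ) := by
  unfold PhiPhi; fun_prop

theorem PhiPhi_good {φ : R2 → R2} (h : IsAreaDiffeo φ) : GoodMap (PhiPhi φ) := by
  obtain ⟨hb, hs, hi, hd⟩ := h
  refine ⟨PhiPhi_contDiff hs, isHomeomorph_of_inverse (PhiPhi_contDiff hs).continuous
    (PhiPhi_contDiff hi).continuous ?_ ?_, ?_, fun p => rfl⟩
  · intro p
    simp [PhiPhi, Function.leftInverse_invFun hb.1 _]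
  · intro p
    simp [PhiPhi, Function.rightInverse_invFun hb.2 _]
  · intro p u v
    have key : ∀ w : R4, fderiv ℝ (PhiPhi φ) p w =
        ((fderiv ℝ φ (p.1, p.2.2.1) (w.1, w.2.2.1)).1, w.2.1,
          (fderiv ℝ φ (p.1, p.2.2.1) (w.1, w.2.2.1)).2, w.2.2.2) := by
      intro w
      have h1 : HasFDerivAt (fun p : R4 => p.1) (ContinuousLinearMap.fst ℝ ℝ (ℝ × ℝ × ℝ)) p :=
        hasFDerivAt_fst
      have h2' : HasFDerivAt (fun p : R4 => p.2) (ContinuousLinearMap.snd ℝ ℝ (ℝ × ℝ × ℝ)) p :=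
        hasFDerivAt_snd
      have h2 := h2'.fst
      have h3 := h2'.snd.fst
      have h4 := h2'.snd.snd
      have h0 : HasFDerivAt φ (fderiv ℝ φ (p.1, p.2.2.1)) (p.1, p.2.2.1) :=
        (hs.differentiable (by simp) _).hasFDerivAt
      have hc := HasFDerivAt.comp (f := fun p : R4 => (p.1, p.2.2.1)) p h0 (h1.prodMk h3)
      have h5 : HasFDerivAt (PhiPhi φ) _ p := hc.fst.prodMk (h2.prodMk (hc.snd.prodMk h4))
      rw [h5.fderiv]
      rfl
    rw [key, key]
    have := det_two _ (hd (p.1, p.2.2.1)) (u.1, u.2.2.1) (v.1, v.2.2.1)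
    simp only [ContinuousLinearMap.coe_coe] at this
    simp only [omega4]
    linear_combination this

theorem omega4_nondeg (u : R4) (h : ∀ v, omega4 u v = 0) : u = 0 := by
  have h1 := h (1, 0, 0, 0)
  have h2 := h (0, 1, 0, 0)
  have h3 := h (0, 0, 1, 0)
  have h4 := h (0, 0, 0, 1)
  simp [omega4] at h1 h2 h3 h4
  ext <;> simp [*]

theorem GoodMap.flatParam {ψ : R4 → R4} (h : GoodMap ψ) {f : R2 → R4} (hf : IsFlatParam f)
    (h0 : ∀ q ∈ Set.range f, q.2.2.2 = 0 → ψ q = q) : IsFlatParam (ψ ∘ f) := by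
  obtain ⟨h1, h2, h3, h4, h5, K, hK, h6⟩ := hf
  have hder : ∀ p u, fderiv ℝ (ψ ∘ f) p u = fderiv ℝ ψ (f p) (fderiv ℝ f p u) := by
    intro p u
    rw [fderiv_comp p (h.1.differentiable (by simp) _) (h1.differentiable (by simp) _)]
    rfl
  refine ⟨h.1.comp h1, h.2.1.injective.comp h2, ?_, ?_, ?_, K, hK, ?_⟩
  · exact ((h.2.1.homeomorph ψ).isProperMap).comp h3
  · intro p
    rw [injective_iff_map_eq_zero]
    intro u hu
    apply (injective_iff_map_eq_zero _).1 (h4 p)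
    apply omega4_nondeg
    intro v
    rw [← h.2.2.1 (f p), ← hder, hu]
    simp [omega4]
  · intro p u v
    rw [hder, hder, h.2.2.1, h5]
  · intro p hp
    have := h0 (f p) ⟨p, rfl⟩ (by rw [h6 p hp])
    simp only [Function.comp]
    rw [this, h6 p hp]

theorem y1_bounded {L : Set R4} (hL : IsFlatLagrangian L) : ∃ M : ℝ, ∀ q ∈ L, -M ≤ q.2.2.1 := by
  obtain ⟨f, hf, rfl⟩ := hL
  obtain ⟨h1, h2, h3, h4, h5, K, hK, h6⟩ := hf
  have hc : Continuous (fun p => (f p).2.2.1) := by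
    have := h1.continuous
    fun_prop
  obtain ⟨B, hB⟩ := (hK.image hc).bddBelow
  refine ⟨max (-B) 0, ?_⟩
  rintro _ ⟨p, rfl⟩
  by_cases hp : p ∈ K
  · have := hB ⟨p, hp, rfl⟩
    have := le_max_left (-B) 0
    simp only at *
    linarith
  · rw [h6 p hp]; simp

theorem supp_bounded {φ : R2 → R2} (h : IsCompactSupported φ) :
    ∃ M : ℝ, ∀ x y : ℝ, M < y → φ (x, y) = (x, y) := by
  obtain ⟨K, hK, h⟩ := h
  obtain ⟨B, hB⟩ := (hK.image continuous_snd).bddAbove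
  refine ⟨B, fun x y hy => h _ fun hm => ?_⟩
  have := hB ⟨_, hm, rfl⟩
  simp only at this
  linarith

theorem step {L : Set R4} (hL : IsFlatLagrangian L) {c d : ℝ} (hc : c ≠ 0) (hd : d ≠ c)
    {φ : R2 → R2} (hφ : IsAreaDiffeo φ) (hφc : IsCompactSupported φ) :
    ∃ L' : Set R4, IsFlatLagrangian L' ∧ (∀ e, TransverseAt L e → TransverseAt L' e) ∧
      L' ∩ {p : R4 | p.2.2.2 = c} = PhiPhi φ '' (L ∩ {p : R4 | p.2.2.2 = c}) ∧
      L' ∩ {p : R4 | p.2.2.2 = d} = L ∩ {p : R4 | p.2.2.2 = d} := by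
  obtain ⟨M, hM⟩ := y1_bounded hL
  obtain ⟨N, hN⟩ := supp_bounded hφc
  obtain ⟨C, hC⟩ : ∃ C : ℝ, ∀ e : ℝ, e = 0 ∨ e = d → M + N < C * (e - c) ^ 2 := by
    have p0 : 0 < (0 - c) ^ 2 := by have := sub_ne_zero.2 hc.symm; positivity
    have pd : 0 < (d - c) ^ 2 := by have := sub_ne_zero.2 hd; positivity
    refine ⟨max ((M + N + 1) / (0 - c) ^ 2) ((M + N + 1) / (d - c) ^ 2), ?_⟩
    rintro e (rfl | rfl)
    · have := (div_le_iff₀ p0).1 (le_max_left ((M + N + 1) / (0 - c) ^ 2)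
        ((M + N + 1) / (d - c) ^ 2))
      linarith
    · have := (div_le_iff₀ pd).1 (le_max_right ((M + N + 1) / (0 - c) ^ 2)
        ((M + N + 1) / (e - c) ^ 2))
      linarith
  set ψ : R4 → R4 := Th (-C) c ∘ PhiPhi φ ∘ Th C c with hψ
  have hg : GoodMap ψ := (Th_good _ _).comp ((PhiPhi_good hφ).comp (Th_good _ _))
  have hid : ∀ q ∈ L, q.2.2.2 = 0 ∨ q.2.2.2 = d → ψ q = q := by
    intro q hq he
    have h1 : PhiPhi φ (Th C c q) = Th C c q := by
      have := hN (Th C c q).1 (Th C c q).2.2.1 (by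
        have := hM q hq
        have := hC _ he
        simp only [Th]; linarith)
      simp only [PhiPhi, this]
    simp only [hψ, Function.comp, h1, Th_inv]
  have hcc : ∀ q : R4, q.2.2.2 = c → ψ q = PhiPhi φ q := by
    intro q hq
    have h1 : ∀ D, ∀ r : R4, r.2.2.2 = c → Th D c r = r := by
      intro D r hr
      simp only [Th, hr]; ext <;> simp [hr]
    simp only [hψ, Function.comp]
    rw [h1 C q hq]
    exact h1 _ (PhiPhi φ q) hq
  refine ⟨ψ '' L, ?_, ?_, ?_, ?_⟩
  · obtain ⟨f, hf, rfl⟩ := hL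
    exact ⟨ψ ∘ f, hg.flatParam hf (fun q hq h => hid q hq (Or.inl h)), Set.range_comp _ _⟩
  · rintro e ⟨f, hf, rfl, ht⟩
    refine ⟨ψ ∘ f, hg.flatParam hf (fun q hq h => hid q hq (Or.inl h)), Set.range_comp _ _, ?_⟩
    simpa only [Function.comp, hg.2.2.2] using ht
  · ext q
    constructor
    · rintro ⟨⟨r, hr, rfl⟩, hq⟩
      have hq' : r.2.2.2 = c := by rw [← hg.2.2.2]; exact hq
      exact ⟨r, ⟨hr, hq'⟩, (hcc r hq').symm⟩
    · rintro ⟨r, ⟨hr, hq⟩, rfl⟩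
      exact ⟨⟨r, hr, hcc r hq⟩, hq⟩
  · ext q
    constructor
    · rintro ⟨⟨r, hr, rfl⟩, hq⟩
      have hq' : r.2.2.2 = d := by rw [← hg.2.2.2]; exact hq
      rw [hid r hr (Or.inr hq')]
      exact ⟨hr, hq'⟩
    · rintro ⟨hr, hq⟩
      exact ⟨⟨q, hr, hid q hr (Or.inr hq)⟩, hq⟩

theorem PhiPhi_iMap (φ : R2 → R2) (a : ℝ) (S : Set R3) :
    PhiPhi φ '' (iMap a '' S) = iMap a '' (phiTimesId φ '' S) := by
  rw [Set.image_image, Set.image_image]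
  rfl

/-- The relation ◁ is well defined on equivalence classes of slices. -/
theorem rel_well_defined (S T : Set R3) (h : SliceRelStrict S T)
    (φ φ' : R2 → R2) (hφ : IsAreaDiffeo φ) (hφc : IsCompactSupported φ)
    (hφ' : IsAreaDiffeo φ') (hφ'c : IsCompactSupported φ') :
    SliceRelStrict (phiTimesId φ '' S) (phiTimesId φ' '' T) := by
  obtain ⟨L, a, b, hab, hb, hL, hta, htb, hS, hT⟩ := h
  obtain ⟨L₁, hL₁, ht₁, hc₁, hd₁⟩ :=
    step hL (c := a) (d := b) (hab.trans hb).ne hab.ne' hφ hφc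
  obtain ⟨L₂, hL₂, ht₂, hc₂, hd₂⟩ :=
    step hL₁ (c := b) (d := a) hb.ne hab.ne hφ' hφ'c
  refine ⟨L₂, a, b, hab, hb, hL₂, ht₂ _ (ht₁ _ hta), ht₂ _ (ht₁ _ htb), ?_, ?_⟩
  · rw [hd₂, hc₁, hS, PhiPhi_iMap]
  · rw [hc₂, hd₁, hT, PhiPhi_iMap]
end
end

section
/- Let S, S', T, T' ⊆ ℝ³ satisfy S ◁ S' and T ◁ T'. Then there exist compactly supported area-preserving diffeomorphisms ρ and ρ' of ℝ² such that (ρ × id)(S) ∪ (ρ' × id)(T) ◁ (ρ × id)(S') ∪ (ρ' × id)(T'). (Theorem: the strict relation ◁ is compatible with the sum of slices.) -/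
noncomputable section

/-! ### Area preserving maps -/

structure GoodPair (φ ψ : R2 → R2) : Prop where
  s1 : ContDiff ℝ (⊤ : ℕ∞) φ
  s2 : ContDiff ℝ (⊤ : ℕ∞) ψ
  l : Function.LeftInverse ψ φ
  r : Function.RightInverse ψ φ
  d : ∀ p : R2, LinearMap.det ((fderiv ℝ φ p) : R2 →ₗ[ℝ] R2) = 1

theorem GoodPair.area {φ ψ : R2 → R2} (h : GoodPair φ ψ) : IsAreaDiffeo φ := by
  have hb : Function.Bijective φ := ⟨h.l.injective, h.r.surjective⟩
  have hinv : Function.invFun φ = ψ := by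
    funext y
    apply hb.1
    rw [Function.invFun_eq (hb.2 y), h.r y]
  exact ⟨hb, h.s1, by rw [hinv]; exact h.s2, h.d⟩

theorem GoodPair.comp {φ ψ φ' ψ' : R2 → R2} (h : GoodPair φ ψ) (h' : GoodPair φ' ψ') :
    GoodPair (φ ∘ φ') (ψ' ∘ ψ) where
  s1 := h.s1.comp h'.s1
  s2 := h'.s2.comp h.s2
  l := h.l.comp h'.l
  r := h.r.comp h'.r
  d := by
    intro p
    rw [fderiv_comp p (h.s1.differentiable (by simp) _) (h'.s1.differentiable (by simp) _),
      ContinuousLinearMap.toLinearMap_comp, LinearMap.det_comp, h.d, h'.d, one_mul]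

theorem goodPair_id : GoodPair id id where
  s1 := contDiff_id
  s2 := contDiff_id
  l := fun _ => rfl
  r := fun _ => rfl
  d := by intro p; simp

theorem goodPair_trans (c : R2) : GoodPair (fun p => p + c) (fun p => p - c) where
  s1 := by fun_prop
  s2 := by fun_prop
  l := fun _ => by simp
  r := fun _ => by simp
  d := by
    intro p
    have : fderiv ℝ (fun p : R2 => p + c) p = ContinuousLinearMap.id ℝ R2 := by
      rw [fderiv_add_const]; exact fderiv_fun_id
    rw [this]; simp

theorem det_R2 (L : R2 →ₗ[ℝ] R2) :
    LinearMap.det L = (L (1,0)).1 * (L (0,1)).2 - (L (0,1)).1 * (L (1,0)).2 := by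
  rw [← LinearMap.det_toMatrix (Module.Basis.finTwoProd ℝ), Matrix.det_fin_two]
  simp [LinearMap.toMatrix_apply]

def ang (σ M : ℝ) (u : ℝ) : ℝ := σ * (Real.pi * Real.smoothTransition (M + 1 - u))

theorem ang_smooth (σ M : ℝ) : ContDiff ℝ (⊤ : ℕ∞) (ang σ M) := by
  unfold ang
  exact contDiff_const.mul (contDiff_const.mul
    (Real.smoothTransition.contDiff.comp (contDiff_const.sub contDiff_id)))

def rot (σ M : ℝ) (p : R2) : R2 :=
  (Real.cos (ang σ M (p.1^2+p.2^2)) * p.1 - Real.sin (ang σ M (p.1^2+p.2^2)) * p.2,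
   Real.sin (ang σ M (p.1^2+p.2^2)) * p.1 + Real.cos (ang σ M (p.1^2+p.2^2)) * p.2)

theorem rot_smooth (σ M : ℝ) : ContDiff ℝ (⊤ : ℕ∞) (rot σ M) := by
  have h : ContDiff ℝ (⊤ : ℕ∞) (fun p : R2 => ang σ M (p.1^2+p.2^2)) :=
    (ang_smooth σ M).comp (by fun_prop)
  unfold rot
  exact ((h.cos.mul contDiff_fst).sub (h.sin.mul contDiff_snd)).prodMk
    ((h.sin.mul contDiff_fst).add (h.cos.mul contDiff_snd))

theorem rot_norm (σ M : ℝ) (p : R2) :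
    (rot σ M p).1^2 + (rot σ M p).2^2 = p.1^2+p.2^2 := by
  simp only [rot]
  have := Real.sin_sq_add_cos_sq (ang σ M (p.1^2+p.2^2))
  linear_combination (p.1^2+p.2^2) * this

theorem ang_neg (σ M u : ℝ) : ang (-σ) M u = - ang σ M u := by simp [ang]

theorem rot_inv (σ M : ℝ) (p : R2) : rot (-σ) M (rot σ M p) = p := by
  have h := rot_norm σ M p
  have e := Real.sin_sq_add_cos_sq (ang σ M (p.1^2+p.2^2))
  rw [rot, h]
  simp only [ang_neg, Real.cos_neg, Real.sin_neg, rot]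
  ext
  · simp only; linear_combination p.1 * e
  · simp only; linear_combination p.2 * e

theorem rot_det (σ M : ℝ) (p : R2) :
    LinearMap.det ((fderiv ℝ (rot σ M) p) : R2 →ₗ[ℝ] R2) = 1 := by
  set t := deriv (ang σ M) (p.1^2+p.2^2) with ht
  have h1 : HasFDerivAt (fun q : R2 => q.1) (ContinuousLinearMap.fst ℝ ℝ ℝ) p := hasFDerivAt_fst
  have h2 : HasFDerivAt (fun q : R2 => q.2) (ContinuousLinearMap.snd ℝ ℝ ℝ) p := hasFDerivAt_snd
  have hu := (h1.pow 2).add (h2.pow 2)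
  have hd : HasDerivAt (ang σ M) t (p.1^2+p.2^2) :=
    (((ang_smooth σ M).differentiable (by simp)) _).hasDerivAt
  have ha := hd.comp_hasFDerivAt p hu
  have hc := ha.cos
  have hs := ha.sin
  have hr := ((hc.mul h1).sub (hs.mul h2)).prodMk ((hs.mul h1).add (hc.mul h2))
  have hr' : HasFDerivAt (rot σ M) _ p := hr
  rw [hr'.fderiv, det_R2]
  have e := Real.sin_sq_add_cos_sq (ang σ M (p.1^2+p.2^2))
  simp
  set c := Real.cos (ang σ M (p.1^2+p.2^2))
  set s := Real.sin (ang σ M (p.1^2+p.2^2))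
  linear_combination e

theorem goodPair_rot (σ M : ℝ) : GoodPair (rot σ M) (rot (-σ) M) where
  s1 := rot_smooth _ _
  s2 := rot_smooth _ _
  l := rot_inv σ M
  r := fun p => by simpa using rot_inv (-σ) M p
  d := rot_det σ M

theorem rot_out (σ M : ℝ) (p : R2) (h : M + 1 ≤ p.1^2+p.2^2) : rot σ M p = p := by
  have : ang σ M (p.1^2+p.2^2) = 0 := by
    rw [ang, Real.smoothTransition.zero_of_nonpos (by linarith)]; simp
  simp [rot, this]

theorem rot_in (M : ℝ) (p : R2) (h : p.1^2+p.2^2 ≤ M) : rot 1 M p = -p := by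
  have : ang 1 M (p.1^2+p.2^2) = Real.pi := by
    rw [ang, Real.smoothTransition.one_of_one_le (by linarith)]; simp
  ext <;> simp [rot, this]

theorem norm_R2_cases (p : R2) (r : ℝ) (hr : 0 ≤ r) (h : r < ‖p‖) : r ^ 2 ≤ p.1^2+p.2^2 := by
  rw [Prod.norm_def, lt_max_iff, Real.norm_eq_abs, Real.norm_eq_abs] at h
  rcases h with h | h
  · nlinarith [sq_abs p.1, sq_nonneg p.2]
  · nlinarith [sq_abs p.2, sq_nonneg p.1]

theorem exists_translation (R m : ℝ) (hR : 0 ≤ R) (hm : 0 ≤ m) :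
    ∃ ρ : R2 → R2, IsAreaDiffeo ρ ∧ IsCompactSupported ρ ∧
      ∀ p : R2, |p.1| ≤ R → |p.2| ≤ R → ρ p = (p.1 + 2 * m, p.2) := by
  set c : R2 := (m, 0) with hc
  set M : ℝ := 2 * (R + m)^2 with hM
  have hM0 : 0 ≤ M := by positivity
  have key := ((goodPair_trans c).comp (goodPair_rot 1 M)).comp
    ((goodPair_trans (-c)).comp (goodPair_rot 1 M))
  refine ⟨_, key.area, ⟨Metric.closedBall 0 (M + 1 + ‖c‖), isCompact_closedBall _ _, ?_⟩, ?_⟩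
  · intro p hp
    have hp : M + 1 + ‖c‖ < ‖p‖ := by simpa using hp
    have h1 : rot 1 M p = p := by
      apply rot_out
      have := norm_R2_cases p (M+1) (by linarith) (by linarith [norm_nonneg c])
      nlinarith
    have h2 : rot 1 M (p + -c) = p + -c := by
      apply rot_out
      have h3 : ‖p‖ - ‖c‖ ≤ ‖p + -c‖ := by
        rw [← sub_eq_add_neg]; exact norm_sub_norm_le _ _
      have := norm_R2_cases (p + -c) (M+1) (by linarith) (by linarith)
      nlinarith
    simp only [Function.comp, h1, h2]; simp
  · intro p h1 h2
    have h1' := abs_le.1 h1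
    have h2' := abs_le.1 h2
    have e1 : rot 1 M p = -p := by
      apply rot_in
      nlinarith [sq_abs p.1, sq_abs p.2, abs_nonneg p.1, abs_nonneg p.2]
    have e2 : rot 1 M (-p + -c) = -(-p + -c) := by
      apply rot_in
      simp only [hc, Prod.fst_add, Prod.snd_add, Prod.fst_neg, Prod.snd_neg]
      have a1 : (-p.1 + -m)^2 ≤ (R+m)^2 := by apply sq_le_sq'  <;> linarith
      have a2 : (-p.2 + -0)^2 ≤ (R+m)^2 := by apply sq_le_sq'  <;> linarith
      linarith
    simp only [Function.comp, e1, e2]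
    ext
    · simp [hc]; ring
    · simp [hc]

/-! ### Flat parametrizations -/

def flat (p : R2) : R4 := (p.1, p.2, 0, 0)

theorem norm_flat (p : R2) : ‖flat p‖ = ‖p‖ := by
  simp [flat, Prod.norm_def]

theorem proper_of_flat (f : R2 → R4) (hf : Continuous f) (K : Set R2) (hK : IsCompact K)
    (h : ∀ p, p ∉ K → f p = flat p) : IsProperMap f := by
  rw [isProperMap_iff_isCompact_preimage]
  refine ⟨hf, fun C hC => ?_⟩
  apply Metric.isCompact_of_isClosed_isBounded (hC.isClosed.preimage hf)
  obtain ⟨r, hr⟩ := hC.isBounded.exists_norm_le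
  obtain ⟨r', hr'⟩ := hK.isBounded.exists_norm_le
  rw [isBounded_iff_forall_norm_le]
  refine ⟨max r r', fun p hp => ?_⟩
  by_cases hpK : p ∈ K
  · exact (hr' p hpK).trans (le_max_right _ _)
  · rw [← norm_flat, ← h p hpK]
    exact (hr _ hp).trans (le_max_left _ _)

/-- bounding radius of a flat parametrization -/
def Bd (f : R2 → R4) (R : ℝ) : Prop :=
  (∀ p, R < ‖p‖ → f p = flat p) ∧ ∀ p, ‖p‖ ≤ R → ‖f p‖ ≤ R

theorem exists_Bd (f : R2 → R4) (hf : IsFlatParam f) :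
    ∃ R₀ : ℝ, 0 ≤ R₀ ∧ ∀ R, R₀ ≤ R → Bd f R := by
  obtain ⟨hs, -, -, -, -, K, hK, h⟩ := hf
  obtain ⟨r', hr'⟩ := hK.isBounded.exists_norm_le
  obtain ⟨r, hr⟩ := (hK.image hs.continuous).isBounded.exists_norm_le
  refine ⟨max 0 (max r r'), le_max_left _ _, fun R hR => ?_⟩
  have h0 : 0 ≤ R := (le_max_left _ _).trans hR
  have h1 : r ≤ R := (le_max_left _ _).trans ((le_max_right _ _).trans hR)
  have h2 : r' ≤ R := (le_max_right _ _).trans ((le_max_right _ _).trans hR)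
  refine ⟨fun p hp => ?_, fun p hp => ?_⟩
  · apply h
    intro hpK
    linarith [hr' p hpK]
  · by_cases hpK : p ∈ K
    · exact (hr _ ⟨p, hpK, rfl⟩).trans h1
    · rw [h p hpK]
      exact (norm_flat p).le.trans hp

/-- transversality of a parametrization -/
def TrP (f : R2 → R4) (a : ℝ) : Prop :=
  ∀ p : R2, (f p).2.2.2 = a → fderiv ℝ (fun q => (f q).2.2.2) p ≠ 0

/-! shift -/

def shift (s : ℝ) (f : R2 → R4) (p : R2) : R4 := f (p - (s, 0)) + (s, 0, 0, 0)

theorem fderiv_comp_sub_r {E : Type*} [NormedAddCommGroup E] [NormedSpace ℝ E] (f : R2 → E)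
    (c p : R2) : fderiv ℝ (fun q => f (q - c)) p = fderiv ℝ f (p - c) := by
  simp only [sub_eq_add_neg]
  exact fderiv_comp_add_right (-c)

theorem shift_fderiv (s : ℝ) (f : R2 → R4) (p : R2) :
    fderiv ℝ (shift s f) p = fderiv ℝ f (p - (s, 0)) := by
  unfold shift
  rw [fderiv_add_const, fderiv_comp_sub_r]

theorem shift_flat (s : ℝ) (f : R2 → R4) (hf : IsFlatParam f) : IsFlatParam (shift s f) := by
  obtain ⟨hs, hi, -, hd, ho, K, hK, h⟩ := hf
  have hs' : ContDiff ℝ (⊤ : ℕ∞) (shift s f) :=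
    (hs.comp (contDiff_id.sub contDiff_const)).add contDiff_const
  have hK' : IsCompact ((fun p : R2 => p + (s, 0)) '' K) := hK.image (by fun_prop)
  have hfl : ∀ p, p ∉ ((fun p : R2 => p + (s, 0)) '' K) → shift s f p = flat p := by
    intro p hp
    have : p - (s, 0) ∉ K := fun hh => hp ⟨_, hh, by simp⟩
    rw [shift, h _ this]
    ext <;> simp [flat]
  refine ⟨hs', ?_, proper_of_flat _ hs'.continuous _ hK' hfl, ?_, ?_, _, hK', hfl⟩
  · intro p q hpq
    have := hi (add_right_cancel hpq)
    exact sub_left_injective this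
  · intro p; rw [shift_fderiv]; exact hd _
  · intro p u v; rw [shift_fderiv]; exact ho _ _ _

theorem shift_tr (s a : ℝ) (f : R2 → R4) (hf : TrP f a) : TrP (shift s f) a := by
  intro p hp
  have e : (fun q => (shift s f q).2.2.2) = fun q => (fun r => (f r).2.2.2) (q - (s, 0)) := by
    funext q; simp [shift]
  rw [e, fderiv_comp_sub_r (fun r => (f r).2.2.2) (s, 0) p]
  apply hf
  simpa [shift] using hp

/-! join -/

def join (m : ℝ) (f g : R2 → R4) (p : R2) : R4 := if p.1 ≤ m then f p else g p

structure LeftOk (m : ℝ) (f : R2 → R4) : Prop where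
  fl : ∀ p : R2, m - 1 < p.1 → f p = flat p
  bd : ∀ p : R2, p.1 ≤ m → (f p).1 ≤ m

structure RightOk (m : ℝ) (f : R2 → R4) : Prop where
  fl : ∀ p : R2, p.1 < m + 1 → f p = flat p
  bd : ∀ p : R2, m < p.1 → m < (f p).1

theorem join_local (m : ℝ) (f g : R2 → R4) (hf : LeftOk m f) (hg : RightOk m g) (p : R2) :
    join m f g =ᶠ[nhds p] f ∨ join m f g =ᶠ[nhds p] g := by
  by_cases hp : p.1 ≤ m
  · left
    have : ∀ᶠ q : R2 in nhds p, q.1 < m + 1 :=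
      (continuous_fst.tendsto p).eventually (gt_mem_nhds (by linarith))
    filter_upwards [this] with q hq
    unfold join
    split_ifs with h
    · rfl
    · rw [hg.fl q hq, hf.fl q (by linarith)]
  · right
    have : ∀ᶠ q : R2 in nhds p, m - 1 < q.1 :=
      (continuous_fst.tendsto p).eventually (lt_mem_nhds (by linarith))
    filter_upwards [this] with q hq
    unfold join
    split_ifs with h
    · rw [hf.fl q hq, hg.fl q (by linarith)]
    · rfl

theorem join_flat (m : ℝ) (f g : R2 → R4) (hf : LeftOk m f) (hg : RightOk m g)
    (Hf : IsFlatParam f) (Hg : IsFlatParam g) : IsFlatParam (join m f g) := by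
  obtain ⟨fs, fi, -, fd, fo, K, hK, hKf⟩ := Hf
  obtain ⟨gs, gi, -, gd, go, K', hK', hKg⟩ := Hg
  have loc := join_local m f g hf hg
  have hs : ContDiff ℝ (⊤ : ℕ∞) (join m f g) := by
    rw [contDiff_iff_contDiffAt]
    intro p
    rcases loc p with h | h
    · exact fs.contDiffAt.congr_of_eventuallyEq h
    · exact gs.contDiffAt.congr_of_eventuallyEq h
  have hfl : ∀ p, p ∉ K ∪ K' → join m f g p = flat p := by
    intro p hp
    unfold join
    split_ifs
    · exact hKf p (fun h => hp (Or.inl h))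
    · exact hKg p (fun h => hp (Or.inr h))
  refine ⟨hs, ?_, proper_of_flat _ hs.continuous _ (hK.union hK') hfl, ?_, ?_, _,
    hK.union hK', hfl⟩
  · intro p q hpq
    unfold join at hpq
    split_ifs at hpq with h1 h2 h2
    · exact fi hpq
    · have := hf.bd p h1
      have := hg.bd q (by linarith)
      rw [hpq] at *; linarith
    · have := hf.bd q h2
      have := hg.bd p (by linarith)
      rw [hpq] at *; linarith
    · exact gi hpq
  · intro p
    rcases loc p with h | h <;> rw [h.fderiv_eq]
    · exact fd p
    · exact gd p
  · intro p u v
    rcases loc p with h | h <;> rw [h.fderiv_eq]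
    · exact fo p u v
    · exact go p u v

theorem join_tr (m a : ℝ) (f g : R2 → R4) (hf : LeftOk m f) (hg : RightOk m g)
    (Hf : TrP f a) (Hg : TrP g a) : TrP (join m f g) a := by
  intro p hp
  rcases join_local m f g hf hg p with h | h
  · have h' : (fun q => (join m f g q).2.2.2) =ᶠ[nhds p] fun q => (f q).2.2.2 := by
      filter_upwards [h] with q hq
      rw [hq]
    rw [h'.fderiv_eq]
    apply Hf
    rw [← h.eq_of_nhds, hp]
  · have h' : (fun q => (join m f g q).2.2.2) =ᶠ[nhds p] fun q => (g q).2.2.2 := by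
      filter_upwards [h] with q hq
      rw [hq]
    rw [h'.fderiv_eq]
    apply Hg
    rw [← h.eq_of_nhds, hp]

theorem join_range (m : ℝ) (f g : R2 → R4) (hf : LeftOk m f) (hg : RightOk m g) :
    Set.range (join m f g) =
      (Set.range f ∩ {y | y.1 ≤ m}) ∪ (Set.range g ∩ {y | m < y.1}) := by
  ext y
  constructor
  · rintro ⟨p, rfl⟩
    unfold join
    split_ifs with h
    · exact Or.inl ⟨⟨p, rfl⟩, hf.bd p h⟩
    · exact Or.inr ⟨⟨p, rfl⟩, hg.bd p (by linarith)⟩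
  · rintro (⟨⟨p, rfl⟩, h⟩ | ⟨⟨p, rfl⟩, h⟩)
    · refine ⟨p, ?_⟩
      have : p.1 ≤ m := by
        by_contra hc
        push Not at hc
        simp only [Set.mem_ofPred_eq] at h
        rw [hf.fl p (by linarith)] at h
        simp only [flat] at h
        linarith
      simp [join, this]
    · refine ⟨p, ?_⟩
      have : ¬ p.1 ≤ m := by
        intro hc
        simp only [Set.mem_ofPred_eq] at h
        rw [hg.fl p (by linarith)] at h
        simp only [flat] at h
        linarith
      simp [join, this]

theorem R4_fst_le (y : R4) : |y.1| ≤ ‖y‖ := norm_fst_le y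

theorem leftOk_of_Bd (f : R2 → R4) (R : ℝ) (h : Bd f R) : LeftOk (R + 1) f where
  fl := by
    intro p hp
    apply h.1
    have := norm_fst_le p
    rw [Real.norm_eq_abs] at this
    linarith [le_abs_self p.1]
  bd := by
    intro p hp
    by_cases hn : ‖p‖ ≤ R
    · linarith [h.2 p hn, R4_fst_le (f p), le_abs_self (f p).1]
    · rw [h.1 p (not_le.1 hn)]
      exact hp

theorem rightOk_of_Bd (f : R2 → R4) (R : ℝ) (h : Bd f R) :
    RightOk (R + 1) (shift (2 * (R + 1)) f) where
  fl := by
    intro p hp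
    rw [shift, h.1]
    · ext <;> simp [flat]
    · have := norm_fst_le (p - (2 * (R + 1), 0))
      rw [Real.norm_eq_abs] at this
      have h2 := neg_le_abs (p - (2 * (R + 1), (0:ℝ))).1
      simp only [Prod.fst_sub] at this h2
      linarith
  bd := by
    intro p hp
    rw [shift]
    by_cases hn : ‖p - (2 * (R + 1), 0)‖ ≤ R
    · have := R4_fst_le (f (p - (2 * (R + 1), 0)))
      have h2 := neg_le_abs (f (p - (2 * (R + 1), 0))).1
      have h3 := h.2 _ hn
      simp only [Prod.fst_add]
      linarith
    · rw [h.1 _ (not_le.1 hn)]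
      simp [flat, hp]

/-! rescaling of levels -/

theorem st_deriv_zero (x : ℝ) (h : x ≤ 0 ∨ 1 ≤ x) : deriv Real.smoothTransition x = 0 := by
  rcases h with h | h
  · apply IsLocalMin.deriv_eq_zero
    refine Filter.Eventually.of_forall fun y => ?_
    rw [Real.smoothTransition.zero_of_nonpos h]
    exact Real.smoothTransition.nonneg y
  · apply IsLocalMax.deriv_eq_zero
    refine Filter.Eventually.of_forall fun y => ?_
    rw [Real.smoothTransition.one_of_one_le h]
    exact Real.smoothTransition.le_one y

theorem st_deriv_nonneg (x : ℝ) : 0 ≤ deriv Real.smoothTransition x :=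
  Real.smoothTransition.monotone.deriv_nonneg

theorem exists_rescale (a b A B : ℝ) (hab : a < b) (hb : b < 0) (hB : B ≤ b)
    (hA : A - B ≤ a - b) :
    ∃ g g' : ℝ → ℝ, ContDiff ℝ (⊤ : ℕ∞) g ∧ ContDiff ℝ (⊤ : ℕ∞) g' ∧
      (∀ y, HasDerivAt g (g' y) y) ∧ (∀ y, 0 < g' y) ∧
      g 0 = 0 ∧ g a = A ∧ g b = B ∧ g' 0 = 1 ∧ g' a = 1 ∧ g' b = 1 := by
  set c := b - B with hc
  set d := (a - b) - (A - B) with hd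
  have hc0 : 0 ≤ c := by linarith
  have hd0 : 0 ≤ d := by linarith
  have hba : 0 < b - a := by linarith
  have hb' : 0 < -b := by linarith
  let st := Real.smoothTransition
  have sts : ContDiff ℝ (⊤ : ℕ∞) st := Real.smoothTransition.contDiff
  have stds : ContDiff ℝ (⊤ : ℕ∞) (deriv st) := by
    have := (contDiff_infty_iff_deriv (f := st)).1 sts
    exact this.2
  refine ⟨fun y => y + c * (st ((y - b) / (-b)) - 1) + d * (st ((y - a) / (b - a)) - 1),
    fun y => 1 + c * (deriv st ((y - b) / (-b)) * (1 / (-b)))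
      + d * (deriv st ((y - a) / (b - a)) * (1 / (b - a))), ?_, ?_, ?_, ?_, ?_, ?_, ?_, ?_, ?_, ?_⟩
  · fun_prop
  · fun_prop
  · intro y
    have h1 : HasDerivAt (fun y => st ((y - b) / (-b)))
        (deriv st ((y - b) / (-b)) * (1 / (-b))) y :=
      HasDerivAt.comp (h := fun y => (y - b) / (-b)) y
        ((sts.differentiable (by simp)) _).hasDerivAt
        (((hasDerivAt_id y).sub_const b).div_const (-b))
    have h2 : HasDerivAt (fun y => st ((y - a) / (b - a)))
        (deriv st ((y - a) / (b - a)) * (1 / (b - a))) y :=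
      HasDerivAt.comp (h := fun y => (y - a) / (b - a)) y
        ((sts.differentiable (by simp)) _).hasDerivAt
        (((hasDerivAt_id y).sub_const a).div_const (b - a))
    exact ((hasDerivAt_id y).add ((h1.sub_const 1).const_mul c)).add ((h2.sub_const 1).const_mul d)
  · intro y
    have := st_deriv_nonneg ((y - b) / (-b))
    have := st_deriv_nonneg ((y - a) / (b - a))
    positivity
  · have e1 : st ((0 - b) / (-b)) = 1 :=
      Real.smoothTransition.one_of_one_le (by rw [le_div_iff₀ hb']; linarith)
    have e2 : st ((0 - a) / (b - a)) = 1 :=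
      Real.smoothTransition.one_of_one_le (by rw [le_div_iff₀ hba]; linarith)
    simp only [e1, e2]; ring
  · have e1 : st ((a - b) / (-b)) = 0 :=
      Real.smoothTransition.zero_of_nonpos (by rw [div_le_iff₀ hb']; linarith)
    have e2 : st ((a - a) / (b - a)) = 0 :=
      Real.smoothTransition.zero_of_nonpos (by simp)
    simp only [e1, e2]; rw [hc, hd]; ring
  · have e1 : st ((b - b) / (-b)) = 0 :=
      Real.smoothTransition.zero_of_nonpos (by simp)
    have e2 : st ((b - a) / (b - a)) = 1 :=
      Real.smoothTransition.one_of_one_le (by rw [le_div_iff₀ hba]; linarith)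
    simp only [e1, e2]; rw [hc]; ring
  · have e1 : deriv st ((0 - b) / (-b)) = 0 :=
      st_deriv_zero _ (Or.inr (by rw [le_div_iff₀ hb']; linarith))
    have e2 : deriv st ((0 - a) / (b - a)) = 0 :=
      st_deriv_zero _ (Or.inr (by rw [le_div_iff₀ hba]; linarith))
    simp only [e1, e2]; ring
  · have e1 : deriv st ((a - b) / (-b)) = 0 :=
      st_deriv_zero _ (Or.inl (by rw [div_le_iff₀ hb']; linarith))
    have e2 : deriv st ((a - a) / (b - a)) = 0 :=
      st_deriv_zero _ (Or.inl (by simp))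
    simp only [e1, e2]; ring
  · have e1 : deriv st ((b - b) / (-b)) = 0 :=
      st_deriv_zero _ (Or.inl (by simp))
    have e2 : deriv st ((b - a) / (b - a)) = 0 :=
      st_deriv_zero _ (Or.inr (by rw [le_div_iff₀ hba]; linarith))
    simp only [e1, e2]; ring

def psi (g g' : ℝ → ℝ) (y : R4) : R4 := (y.1, y.2.1 * (g' y.2.2.2)⁻¹, y.2.2.1, g y.2.2.2)

section rescale

variable (g g' : ℝ → ℝ)

theorem psi_smooth (gs : ContDiff ℝ (⊤ : ℕ∞) g) (gs' : ContDiff ℝ (⊤ : ℕ∞) g')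
    (hpos : ∀ y, 0 < g' y) : ContDiff ℝ (⊤ : ℕ∞) (psi g g') := by
  unfold psi
  have h4 : ContDiff ℝ (⊤ : ℕ∞) (fun y : R4 => y.2.2.2) := by fun_prop
  refine contDiff_fst.prodMk (ContDiff.prodMk (ContDiff.mul (by fun_prop) ?_)
    (ContDiff.prodMk (by fun_prop) (gs.comp h4)))
  exact (gs'.comp h4).inv fun y => (hpos _).ne'

theorem g_inj (hg : ∀ y, HasDerivAt g (g' y) y) (hpos : ∀ y, 0 < g' y) :
    Function.Injective g :=
  (strictMono_of_deriv_pos fun y => by rw [(hg y).deriv]; exact hpos y).injective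

theorem psi_inj (hg : ∀ y, HasDerivAt g (g' y) y) (hpos : ∀ y, 0 < g' y) :
    Function.Injective (psi g g') := by
  rintro ⟨a, b, c, d⟩ ⟨a', b', c', d'⟩ h
  simp only [psi, Prod.mk.injEq] at h
  obtain ⟨h1, h2, h3, h4⟩ := h
  have h4 := g_inj g g' hg hpos h4
  subst h4
  have := mul_right_cancel₀ (inv_ne_zero (hpos d).ne') h2
  simp [h1, this, h3]

theorem psi_fderiv (gs' : ContDiff ℝ (⊤ : ℕ∞) g')
    (hg : ∀ y, HasDerivAt g (g' y) y) (hpos : ∀ y, 0 < g' y) (y : R4) :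
    ∃ t : ℝ, ∀ v : R4, fderiv ℝ (psi g g') y v =
      (v.1, v.2.1 * (g' y.2.2.2)⁻¹ + t * v.2.2.2, v.2.2.1, g' y.2.2.2 * v.2.2.2) := by
  set k : ℝ → ℝ := fun y => (g' y)⁻¹
  have hk : ContDiff ℝ (⊤ : ℕ∞) k := gs'.inv fun y => (hpos _).ne'
  have hkd : HasDerivAt k (deriv k y.2.2.2) y.2.2.2 :=
    ((hk.differentiable (by simp)) _).hasDerivAt
  have h1 : HasFDerivAt (fun q : R4 => q.1) (ContinuousLinearMap.fst ℝ ℝ (ℝ × ℝ × ℝ)) y :=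
    hasFDerivAt_fst
  have h2 : HasFDerivAt (fun q : R4 => q.2.1) ((ContinuousLinearMap.fst ℝ ℝ (ℝ × ℝ)).comp
      (ContinuousLinearMap.snd ℝ ℝ (ℝ × ℝ × ℝ))) y :=
    (ContinuousLinearMap.hasFDerivAt ((ContinuousLinearMap.fst ℝ ℝ (ℝ × ℝ)).comp
      (ContinuousLinearMap.snd ℝ ℝ (ℝ × ℝ × ℝ))))
  have h3 : HasFDerivAt (fun q : R4 => q.2.2.1) (((ContinuousLinearMap.fst ℝ ℝ ℝ).comp
      (ContinuousLinearMap.snd ℝ ℝ (ℝ × ℝ))).comp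
      (ContinuousLinearMap.snd ℝ ℝ (ℝ × ℝ × ℝ))) y :=
    (ContinuousLinearMap.hasFDerivAt (((ContinuousLinearMap.fst ℝ ℝ ℝ).comp
      (ContinuousLinearMap.snd ℝ ℝ (ℝ × ℝ))).comp
      (ContinuousLinearMap.snd ℝ ℝ (ℝ × ℝ × ℝ))))
  have h4 : HasFDerivAt (fun q : R4 => q.2.2.2) (((ContinuousLinearMap.snd ℝ ℝ ℝ).comp
      (ContinuousLinearMap.snd ℝ ℝ (ℝ × ℝ))).comp
      (ContinuousLinearMap.snd ℝ ℝ (ℝ × ℝ × ℝ))) y :=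
    (ContinuousLinearMap.hasFDerivAt (((ContinuousLinearMap.snd ℝ ℝ ℝ).comp
      (ContinuousLinearMap.snd ℝ ℝ (ℝ × ℝ))).comp
      (ContinuousLinearMap.snd ℝ ℝ (ℝ × ℝ × ℝ))))
  have hk4 := hkd.comp_hasFDerivAt y h4
  have hg4 := (hg y.2.2.2).comp_hasFDerivAt y h4
  have H : HasFDerivAt (psi g g') _ y := h1.prodMk ((h2.mul hk4).prodMk (h3.prodMk hg4))
  refine ⟨y.2.1 * deriv k y.2.2.2, fun v => ?_⟩
  rw [H.fderiv]
  ext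
  · simp
  · simp [k]; ring
  · simp
  · simp

theorem psi_flat (gs : ContDiff ℝ (⊤ : ℕ∞) g) (gs' : ContDiff ℝ (⊤ : ℕ∞) g')
    (hg : ∀ y, HasDerivAt g (g' y) y) (hpos : ∀ y, 0 < g' y) (g0 : g 0 = 0) (g0' : g' 0 = 1)
    (f : R2 → R4) (hf : IsFlatParam f) : IsFlatParam (psi g g' ∘ f) := by
  obtain ⟨fs, fi, -, fd, fo, K, hK, hKf⟩ := hf
  have hs := (psi_smooth g g' gs gs' hpos).comp fs
  have hfl : ∀ p, p ∉ K → (psi g g' ∘ f) p = flat p := by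
    intro p hp
    simp [hKf p hp, psi, flat, g0, g0']
  have hfd : ∀ p, fderiv ℝ (psi g g' ∘ f) p = (fderiv ℝ (psi g g') (f p)).comp (fderiv ℝ f p) :=
    fun p => fderiv_comp p (((psi_smooth g g' gs gs' hpos).differentiable (by simp)) _)
      ((fs.differentiable (by simp)) _)
  refine ⟨hs, (psi_inj g g' hg hpos).comp fi, proper_of_flat _ hs.continuous K hK hfl, ?_, ?_,
    K, hK, hfl⟩
  · intro p
    rw [hfd]
    rw [ContinuousLinearMap.coe_comp]
    refine Function.Injective.comp ?_ (fd p)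
    obtain ⟨t, ht⟩ := psi_fderiv g g' gs' hg hpos (f p)
    rintro ⟨a, b, c, d⟩ ⟨a', b', c', d'⟩ h
    rw [ht, ht] at h
    simp only [Prod.mk.injEq] at h
    obtain ⟨e1, e2, e3, e4⟩ := h
    have e4 := mul_left_cancel₀ (hpos _).ne' e4
    subst e4
    have := mul_right_cancel₀ (inv_ne_zero (hpos _).ne') (add_right_cancel e2)
    simp [e1, this, e3]
  · intro p u v
    rw [hfd]
    obtain ⟨t, ht⟩ := psi_fderiv g g' gs' hg hpos (f p)
    simp only [ContinuousLinearMap.comp_apply, ht]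
    have := fo p u v
    rw [← this]
    simp only [omega4]
    have := (hpos (f p).2.2.2).ne'
    field_simp
    ring

theorem psi_tr (hg : ∀ y, HasDerivAt g (g' y) y) (hpos : ∀ y, 0 < g' y) (f : R2 → R4) (hf : IsFlatParam f)
    (a : ℝ) (h : TrP f a) : TrP (psi g g' ∘ f) (g a) := by
  intro p hp
  have hp' := g_inj g g' hg hpos hp
  have h4 : DifferentiableAt ℝ (fun q => (f q).2.2.2) p :=
    ((hf.1.differentiable (by simp)) p).snd.snd.snd
  have := (hg (f p).2.2.2).comp_hasFDerivAt p h4.hasFDerivAt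
  have e : HasFDerivAt (fun q => ((psi g g' ∘ f) q).2.2.2) _ p := this
  rw [e.fderiv]
  exact smul_ne_zero (hpos _).ne' (h p hp')

theorem psi_slice (hg : ∀ y, HasDerivAt g (g' y) y) (hpos : ∀ y, 0 < g' y) (L : Set R4)
    (a : ℝ) (ha : g' a = 1) (S : Set R3) (h : L ∩ {p : R4 | p.2.2.2 = a} = iMap a '' S) :
    (psi g g' '' L) ∩ {p : R4 | p.2.2.2 = g a} = iMap (g a) '' S := by
  ext y
  constructor
  · rintro ⟨⟨z, hz, rfl⟩, hy⟩
    have hz4 : z.2.2.2 = a := g_inj g g' hg hpos hy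
    have : z ∈ iMap a '' S := by rw [← h]; exact ⟨hz, hz4⟩
    obtain ⟨s, hs, rfl⟩ := this
    exact ⟨s, hs, by simp [iMap, psi, ha]⟩
  · rintro ⟨s, hs, rfl⟩
    have : iMap a s ∈ L ∩ {p : R4 | p.2.2.2 = a} := by rw [h]; exact ⟨s, hs, rfl⟩
    exact ⟨⟨_, this.1, by simp [iMap, psi, ha]⟩, rfl⟩

end rescale

theorem rescale (S S' : Set R3) (h : SliceRelStrict S S') :
    ∃ a b : ℝ, a < b ∧ b < 0 ∧ ∀ A B : ℝ, B ≤ b → A - B ≤ a - b →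
      ∃ (L : Set R4) (f f' : R2 → R4), IsFlatParam f ∧ IsFlatParam f' ∧
        Set.range f = L ∧ Set.range f' = L ∧ TrP f A ∧ TrP f' B ∧
        L ∩ {p : R4 | p.2.2.2 = A} = iMap A '' S ∧
        L ∩ {p : R4 | p.2.2.2 = B} = iMap B '' S' := by
  obtain ⟨L, a, b, hab, hb, -, ⟨f, hf, rf, tf⟩, ⟨f', hf', rf', tf'⟩, s1, s2⟩ := h
  refine ⟨a, b, hab, hb, fun A B hB hA => ?_⟩
  obtain ⟨g, g', gs, gs', hg, hpos, g0, ga, gb, g0', ga', gb'⟩ := exists_rescale a b A B hab hb hB hA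
  refine ⟨psi g g' '' L, psi g g' ∘ f, psi g g' ∘ f', psi_flat g g' gs gs' hg hpos g0 g0' f hf,
    psi_flat g g' gs gs' hg hpos g0 g0' f' hf', by rw [Set.range_comp, rf],
    by rw [Set.range_comp, rf'], ?_, ?_, ?_, ?_⟩
  · rw [← ga]; exact psi_tr g g' hg hpos f hf a tf
  · rw [← gb]; exact psi_tr g g' hg hpos f' hf' b tf'
  · rw [← ga]; exact psi_slice g g' hg hpos L a ga' S s1
  · rw [← gb]; exact psi_slice g g' hg hpos L b gb' S' s2

theorem shift_range (s : ℝ) (f : R2 → R4) :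
    Set.range (shift s f) = trX1 s '' Set.range f := by
  ext y
  constructor
  · rintro ⟨p, rfl⟩
    exact ⟨_, ⟨p - (s, 0), rfl⟩, by ext <;> simp [trX1, shift]⟩
  · rintro ⟨_, ⟨p, rfl⟩, rfl⟩
    exact ⟨p + (s, 0), by ext <;> simp [trX1, shift]⟩

/-- bound for points below zero -/
theorem low_bound (f : R2 → R4) (R : ℝ) (h : Bd f R) (y : R4) (hy : y ∈ Set.range f)
    (hy4 : y.2.2.2 ≠ 0) : ‖y‖ ≤ R := by
  obtain ⟨p, rfl⟩ := hy
  apply h.2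
  by_contra hc
  rw [h.1 p (not_le.1 hc)] at hy4
  exact hy4 rfl

theorem slice_sum (f1 f2 : R2 → R4) (R : ℝ) (h1 : Bd f1 R) (h2 : Bd f2 R)
    (A : ℝ) (hA : A < 0) (S T : Set R3)
    (hS : Set.range f1 ∩ {p : R4 | p.2.2.2 = A} = iMap A '' S)
    (hT : Set.range f2 ∩ {p : R4 | p.2.2.2 = A} = iMap A '' T)
    (ρ : R2 → R2)
    (hρ : ∀ p : R2, |p.1| ≤ R → |p.2| ≤ R → ρ p = (p.1 + 2 * (R + 1), p.2)) :
    ((Set.range f1 ∩ {y | y.1 ≤ R + 1}) ∪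
      (trX1 (2 * (R + 1)) '' Set.range f2 ∩ {y | R + 1 < y.1})) ∩ {p : R4 | p.2.2.2 = A}
      = iMap A '' (phiTimesId id '' S ∪ phiTimesId ρ '' T) := by
  have bT : ∀ t ∈ T, phiTimesId ρ t = (t.1 + 2 * (R + 1), t.2.1, t.2.2) ∧ |t.1| ≤ R := by
    intro t ht
    have : iMap A t ∈ Set.range f2 ∩ {p : R4 | p.2.2.2 = A} := by rw [hT]; exact ⟨t, ht, rfl⟩
    have hb := low_bound f2 R h2 _ this.1 (by simp [iMap, hA.ne])
    have b1 : |t.1| ≤ R := (norm_fst_le (iMap A t)).trans hb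
    have b3 : |t.2.2| ≤ R :=
      (norm_fst_le (iMap A t).2.2).trans
        ((norm_snd_le (iMap A t).2).trans ((norm_snd_le (iMap A t)).trans hb))
    refine ⟨?_, b1⟩
    rw [phiTimesId, hρ (t.1, t.2.2) b1 b3]
  ext y
  constructor
  · rintro ⟨(⟨hy, -⟩ | ⟨⟨z, hz, rfl⟩, -⟩), h4⟩
    · have : y ∈ iMap A '' S := by rw [← hS]; exact ⟨hy, h4⟩
      obtain ⟨s, hs, rfl⟩ := this
      exact ⟨s, Or.inl ⟨s, hs, rfl⟩, rfl⟩
    · have : z ∈ iMap A '' T := by rw [← hT]; exact ⟨hz, h4⟩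
      obtain ⟨t, ht, rfl⟩ := this
      exact ⟨_, Or.inr ⟨t, ht, rfl⟩, by rw [(bT t ht).1]; rfl⟩
  · rintro ⟨_, (⟨s, hs, rfl⟩ | ⟨t, ht, rfl⟩), rfl⟩
    · have : iMap A s ∈ Set.range f1 ∩ {p : R4 | p.2.2.2 = A} := by rw [hS]; exact ⟨s, hs, rfl⟩
      refine ⟨Or.inl ⟨this.1, ?_⟩, rfl⟩
      have hb := low_bound f1 R h1 _ this.1 (by simp [iMap, hA.ne])
      have b1 : |s.1| ≤ R := (norm_fst_le (iMap A s)).trans hb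
      have := le_abs_self s.1
      change s.1 ≤ R + 1
      linarith
    · have : iMap A t ∈ Set.range f2 ∩ {p : R4 | p.2.2.2 = A} := by rw [hT]; exact ⟨t, ht, rfl⟩
      obtain ⟨e, b⟩ := bT t ht
      rw [e]
      refine ⟨Or.inr ⟨⟨_, this.1, rfl⟩, ?_⟩, rfl⟩
      have := neg_le_abs t.1
      change R + 1 < t.1 + 2 * (R + 1)
      linarith

/-- The strict relation ◁ is compatible with the sum of slices. -/
theorem rel_compatible_with_sum (S S' T T' : Set R3)
    (h1 : SliceRelStrict S S') (h2 : SliceRelStrict T T') :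
    ∃ ρ ρ' : R2 → R2,
      IsAreaDiffeo ρ ∧ IsCompactSupported ρ ∧ IsAreaDiffeo ρ' ∧ IsCompactSupported ρ' ∧
      SliceRelStrict (phiTimesId ρ '' S ∪ phiTimesId ρ' '' T)
        (phiTimesId ρ '' S' ∪ phiTimesId ρ' '' T') := by
  obtain ⟨a1, b1, hab1, hb1, k1⟩ := rescale S S' h1
  obtain ⟨a2, b2, hab2, hb2, k2⟩ := rescale T T' h2
  set B := min b1 b2 with hBd
  have hB1 : B ≤ b1 := min_le_left _ _
  have hB2 : B ≤ b2 := min_le_right _ _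
  set A := B + min (a1 - b1) (a2 - b2) with hAd
  have hA1 : A - B ≤ a1 - b1 := by have := min_le_left (a1 - b1) (a2 - b2); linarith
  have hA2 : A - B ≤ a2 - b2 := by have := min_le_right (a1 - b1) (a2 - b2); linarith
  have hAB : A < B := by linarith
  have hB0 : B < 0 := by linarith
  obtain ⟨L1, f1, f1', hf1, hf1', r1, r1', t1, t1', s1, s1'⟩ := k1 A B hB1 hA1
  obtain ⟨L2, f2, f2', hf2, hf2', r2, r2', t2, t2', s2, s2'⟩ := k2 A B hB2 hA2
  obtain ⟨R1, hR1, H1⟩ := exists_Bd f1 hf1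
  obtain ⟨R2, hR2, H2⟩ := exists_Bd f2 hf2
  obtain ⟨R3, hR3, H3⟩ := exists_Bd f1' hf1'
  obtain ⟨R4, hR4, H4⟩ := exists_Bd f2' hf2'
  set R := R1 + R2 + R3 + R4 with hR
  have H1 := H1 R (by linarith)
  have H2 := H2 R (by linarith)
  have H3 := H3 R (by linarith)
  have H4 := H4 R (by linarith)
  obtain ⟨ρ, ρa, ρc, hρ⟩ := exists_translation R (R + 1) (by linarith) (by linarith)
  refine ⟨id, ρ, goodPair_id.area, ⟨∅, isCompact_empty, fun _ _ => rfl⟩, ρa, ρc, ?_⟩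
  have l1 := leftOk_of_Bd f1 R H1
  have l1' := leftOk_of_Bd f1' R H3
  have q2 := rightOk_of_Bd f2 R H2
  have q2' := rightOk_of_Bd f2' R H4
  have J := join_flat _ _ _ l1 q2 hf1 (shift_flat _ _ hf2)
  have J' := join_flat _ _ _ l1' q2' hf1' (shift_flat _ _ hf2')
  have rg := join_range _ _ _ l1 q2
  have rg' := join_range _ _ _ l1' q2'
  rw [shift_range] at rg rg'
  refine ⟨_, A, B, hAB, hB0, ⟨_, J, rg⟩,
    ⟨_, J, rg, join_tr _ _ _ _ l1 q2 t1 (shift_tr _ _ _ t2)⟩,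
    ⟨_, J', by rw [rg', r1', r2', r1, r2], join_tr _ _ _ _ l1' q2' t1' (shift_tr _ _ _ t2')⟩,
    ?_, ?_⟩
  · exact slice_sum f1 f2 R H1 H2 A (by linarith) S T (by rw [r1]; exact s1)
      (by rw [r2]; exact s2) ρ hρ
  · exact slice_sum f1 f2 R H1 H2 B hB0 S' T' (by rw [r1]; exact s1')
      (by rw [r2]; exact s2') ρ hρ
end
end
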